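/- arXiv:1407.5703 — 2 statements merged into one kernel-verified Lean document; each statement's English description precedes it below -/
import Mathlib

section
/- Let $D \subset\subset \mathbb{C}^n$ be a bounded domain, $0 \leq \alpha, \beta < 2n$ and $\gamma > -2n$. Then there exists $C > 0$ such that for all $x \in \mathbb{C}^n$ with $x \neq 0$: $\int_D \|\zeta\|^{\gamma}\,\|\zeta - x\|^{-\alpha}\,\|\zeta + x\|^{-\beta}\, dV(\zeta) \leq C$ if $\alpha+\beta < 2n+\gamma$; $\leq C(1 + |\log\|x\||)$ if $\alpha+\beta = 2n+\gamma$; and $\leq C\,\|x\|^{2n+\gamma-\alpha-\beta}$ if $\alpha+\beta > 2n+\gamma$. -/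
open MeasureTheory

noncomputable instance (n : ℕ) : MeasurableSpace (EuclideanSpace ℂ (Fin n)) := borel _
instance (n : ℕ) : BorelSpace (EuclideanSpace ℂ (Fin n)) := ⟨rfl⟩
noncomputable instance (n : ℕ) : InnerProductSpace ℝ (EuclideanSpace ℂ (Fin n)) :=
  InnerProductSpace.rclikeToReal ℂ _

section

open Set

section PowerIntegrals

theorem integrableOn_Iio_inter_Ioi_rpow {t : ℝ} (ht : 0 < t) (ρ : ℝ) :
    IntegrableOn (fun y : ℝ => y ^ (t - 1)) (Iio ρ ∩ Ioi 0) := by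
  rw [Iio_inter_Ioi]
  rcases le_total 0 ρ with h | h
  · exact (intervalIntegrable_iff_integrableOn_Ioo_of_le h).1
      (intervalIntegral.intervalIntegrable_rpow' (by linarith))
  · simp [Ioo_eq_empty_of_le h]

theorem integral_Iio_inter_Ioi_rpow {t ρ : ℝ} (ht : 0 < t) (hρ : 0 ≤ ρ) :
    ∫ y in Iio ρ ∩ Ioi 0, y ^ (t - 1) = ρ ^ t / t := by
  rw [Iio_inter_Ioi, ← integral_Ioc_eq_integral_Ioo, ← intervalIntegral.integral_of_le hρ,
    integral_rpow (Or.inl (by linarith))]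
  simp [Real.zero_rpow ht.ne']

theorem integrableOn_Ico_rpow {a : ℝ} (ha : 0 < a) (b s : ℝ) :
    IntegrableOn (fun y : ℝ => y ^ s) (Ico a b) := by
  refine (ContinuousOn.integrableOn_Icc (a := a) (b := b) ?_).mono_set Ico_subset_Icc_self
  exact fun y hy => (Real.continuousAt_rpow_const _ _
    (Or.inl (ha.trans_le hy.1).ne')).continuousWithinAt

theorem integral_Ico_rpow_le_of_pos {a b t : ℝ} (ha : 0 < a) (hb : 0 ≤ b) (ht : 0 < t) :
    ∫ y in Ico a b, y ^ (t - 1) ≤ b ^ t / t := by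
  rw [← integral_Iio_inter_Ioi_rpow ht hb]
  refine setIntegral_mono_set (integrableOn_Iio_inter_Ioi_rpow ht b) ?_ ?_
  · filter_upwards [ae_restrict_mem (measurableSet_Iio.inter measurableSet_Ioi)] with y hy
    exact Real.rpow_nonneg (le_of_lt hy.2) _
  · exact LE.le.eventuallyLE fun y hy => ⟨hy.2, ha.trans_le hy.1⟩

theorem integral_Ico_rpow_le_of_neg {a b t : ℝ} (ha : 0 < a) (ht : t < 0) :
    ∫ y in Ico a b, y ^ (t - 1) ≤ a ^ t / (-t) := by
  have h := integral_Ioi_rpow_of_lt (a := t - 1) (by linarith) ha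
  rw [sub_add_cancel, neg_div, ← div_neg] at h
  rw [← h, ← integral_Ici_eq_integral_Ioi]
  refine setIntegral_mono_set ?_ ?_ (LE.le.eventuallyLE Ico_subset_Ici_self)
  · exact (integrableOn_Ici_iff_integrableOn_Ioi (by simp)).2 (integrableOn_Ioi_rpow_of_lt (by linarith) ha)
  · filter_upwards [ae_restrict_mem measurableSet_Ici] with y hy
    exact Real.rpow_nonneg (ha.le.trans hy) _

theorem integral_Ico_rpow_neg_one_le {a b : ℝ} (ha : 0 < a) (hb : 0 < b) :
    ∫ y in Ico a b, y ^ (-1 : ℝ) ≤ |Real.log a| + |Real.log b| := by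
  rcases le_total a b with h | h
  · rw [integral_Ico_eq_integral_Ioo, ← integral_Ioc_eq_integral_Ioo,
      ← intervalIntegral.integral_of_le h]
    simp_rw [Real.rpow_neg_one]
    rw [integral_inv_of_pos ha hb, Real.log_div hb.ne' ha.ne']
    linarith [neg_abs_le (Real.log a), le_abs_self (Real.log b)]
  · rw [Ico_eq_empty_of_le h]
    simp only [Measure.restrict_empty, integral_zero_measure]
    positivity

end PowerIntegrals

section Radial

variable {E : Type*} [NormedAddCommGroup E] [NormedSpace ℝ E] [MeasurableSpace E] [BorelSpace E]
  [FiniteDimensional ℝ E] [Nontrivial E] (μ : Measure E) [μ.IsAddHaarMeasure]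

theorem pow_smul_indicator_rpow_eqOn (d : ℕ) (hd : 0 < d) (S : Set ℝ) (s : ℝ) :
    EqOn (fun y : ℝ => y ^ (d - 1) • S.indicator (fun y => y ^ s) y)
      (S.indicator fun y => y ^ (d + s - 1)) (Ioi 0) := by
  intro y hy
  have hy : 0 < y := hy
  by_cases h : y ∈ S
  · simp only [indicator_of_mem h, smul_eq_mul]
    rw [← Real.rpow_natCast, ← Real.rpow_add hy, Nat.cast_sub hd]
    congr 1
    push_cast
    ring
  · simp [indicator_of_notMem h]

theorem integrable_indicator_rpow_norm {S : Set ℝ} (hS : MeasurableSet S) {s : ℝ}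
    (h : IntegrableOn (fun y : ℝ => y ^ (Module.finrank ℝ E + s - 1)) (S ∩ Ioi 0)) :
    Integrable (fun ζ : E => S.indicator (fun y => y ^ s) ‖ζ‖) μ := by
  rw [integrable_fun_norm_addHaar μ,
    integrableOn_congr_fun (pow_smul_indicator_rpow_eqOn _ Module.finrank_pos S s)
      measurableSet_Ioi, integrableOn_indicator_iff hS]
  exact h

theorem integral_indicator_rpow_norm {S : Set ℝ} (hS : MeasurableSet S) (s : ℝ) :
    ∫ ζ : E, S.indicator (fun y => y ^ s) ‖ζ‖ ∂μ =
      Module.finrank ℝ E * μ.real (Metric.ball 0 1) *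
        ∫ y in S ∩ Ioi 0, y ^ (Module.finrank ℝ E + s - 1) := by
  rw [integral_fun_norm_addHaar μ,
    setIntegral_congr_fun measurableSet_Ioi
      (pow_smul_indicator_rpow_eqOn _ Module.finrank_pos S s),
    setIntegral_indicator hS, inter_comm, nsmul_eq_mul, smul_eq_mul, mul_assoc]

theorem integrable_indicator_Iio_rpow_norm {s : ℝ} (hs : 0 < Module.finrank ℝ E + s) (ρ : ℝ) :
    Integrable (fun ζ : E => (Iio ρ).indicator (fun y => y ^ s) ‖ζ‖) μ :=
  integrable_indicator_rpow_norm μ measurableSet_Iio (integrableOn_Iio_inter_Ioi_rpow hs ρ)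

theorem integral_indicator_Iio_rpow_norm {s : ℝ} (hs : 0 < Module.finrank ℝ E + s) {ρ : ℝ}
    (hρ : 0 ≤ ρ) :
    ∫ ζ : E, (Iio ρ).indicator (fun y => y ^ s) ‖ζ‖ ∂μ =
      Module.finrank ℝ E * μ.real (Metric.ball 0 1) *
        (ρ ^ (Module.finrank ℝ E + s) / (Module.finrank ℝ E + s)) := by
  rw [integral_indicator_rpow_norm μ measurableSet_Iio, integral_Iio_inter_Ioi_rpow hs hρ]

end Radial

section Kernel

variable {E : Type*} [NormedAddCommGroup E]

theorem rpow_le_two_rpow_abs_mul_rpow {u r : ℝ} (hr : 0 < r) (h₁ : r / 2 ≤ u) (h₂ : u ≤ 2 * r)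
    (γ : ℝ) : u ^ γ ≤ 2 ^ |γ| * r ^ γ := by
  have hu : 0 < u := by linarith
  rcases le_total 0 γ with h | h
  · rw [abs_of_nonneg h, ← Real.mul_rpow zero_le_two hr.le]
    exact Real.rpow_le_rpow hu.le h₂ h
  · rw [abs_of_nonpos h, Real.rpow_neg zero_le_two, ← div_eq_inv_mul,
      ← Real.div_rpow hr.le zero_le_two]
    exact Real.rpow_le_rpow_of_nonpos (by linarith) h₁ h

theorem div_two_rpow_neg {u : ℝ} (hu : 0 ≤ u) (a : ℝ) : (u / 2) ^ (-a) = 2 ^ a * u ^ (-a) := by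
  rw [Real.div_rpow hu zero_le_two, Real.rpow_neg zero_le_two, div_inv_eq_mul, mul_comm]

theorem kernel_le_of_le_norm {α β γ u : ℝ} (hα : 0 ≤ α) (hβ : 0 ≤ β) (hu : 0 < u) {x ζ : E}
    (h₁ : u / 2 ≤ ‖ζ - x‖) (h₂ : u / 2 ≤ ‖ζ + x‖) :
    ‖ζ‖ ^ γ * (‖ζ - x‖ ^ (-α) * ‖ζ + x‖ ^ (-β)) ≤
      2 ^ (α + β) * u ^ (-α - β) * ‖ζ‖ ^ γ := by
  have hu2 : 0 < u / 2 := by linarith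
  have h : ‖ζ - x‖ ^ (-α) * ‖ζ + x‖ ^ (-β) ≤ 2 ^ (α + β) * u ^ (-α - β) := by
    calc _ ≤ (u / 2) ^ (-α) * (u / 2) ^ (-β) :=
          mul_le_mul (Real.rpow_le_rpow_of_nonpos hu2 h₁ (by linarith))
            (Real.rpow_le_rpow_of_nonpos hu2 h₂ (by linarith)) (by positivity) (by positivity)
      _ = _ := by
          rw [← Real.rpow_add hu2, ← neg_add, div_two_rpow_neg hu.le, neg_add, sub_eq_add_neg]
  rw [mul_comm]
  exact mul_le_mul_of_nonneg_right h (by positivity)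

theorem kernel_le_of_two_mul_norm_le {α β γ : ℝ} (hα : 0 ≤ α) (hβ : 0 ≤ β) {x ζ : E}
    (hx : x ≠ 0) (h : 2 * ‖ζ‖ ≤ ‖x‖) :
    ‖ζ‖ ^ γ * (‖ζ - x‖ ^ (-α) * ‖ζ + x‖ ^ (-β)) ≤
      2 ^ (α + β) * ‖x‖ ^ (-α - β) * ‖ζ‖ ^ γ := by
  refine kernel_le_of_le_norm hα hβ (norm_pos_iff.2 hx) ?_ ?_
  · have := norm_sub_norm_le x ζ
    rw [norm_sub_rev] at this
    linarith
  · have := norm_sub_norm_le x (-ζ)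
    rw [sub_neg_eq_add, norm_neg, add_comm] at this
    linarith

theorem kernel_le_of_two_mul_norm_le' {α β γ : ℝ} (hα : 0 ≤ α) (hβ : 0 ≤ β) {x ζ : E}
    (hx : x ≠ 0) (h : 2 * ‖x‖ ≤ ‖ζ‖) :
    ‖ζ‖ ^ γ * (‖ζ - x‖ ^ (-α) * ‖ζ + x‖ ^ (-β)) ≤ 2 ^ (α + β) * ‖ζ‖ ^ (γ - α - β) := by
  have hx' := norm_pos_iff.2 hx
  have hζ : 0 < ‖ζ‖ := by linarith
  refine (kernel_le_of_le_norm hα hβ hζ ?_ ?_).trans_eq ?_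
  · have := norm_sub_norm_le ζ x
    linarith
  · have := norm_sub_norm_le ζ (-x)
    rw [sub_neg_eq_add, norm_neg] at this
    linarith
  · rw [mul_assoc, ← Real.rpow_add hζ]
    ring_nf

theorem kernel_le_of_norm_comparable [NormedSpace ℝ E] {α β γ : ℝ} (hα : 0 ≤ α) (hβ : 0 ≤ β) {x ζ : E}
    (hx : x ≠ 0) (h₁ : ‖x‖ / 2 ≤ ‖ζ‖) (h₂ : ‖ζ‖ ≤ 2 * ‖x‖) :
    ‖ζ‖ ^ γ * (‖ζ - x‖ ^ (-α) * ‖ζ + x‖ ^ (-β)) ≤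
      2 ^ |γ| * ‖x‖ ^ (γ - β) * ‖ζ - x‖ ^ (-α) + 2 ^ |γ| * ‖x‖ ^ (γ - α) * ‖ζ + x‖ ^ (-β) := by
  have hx' := norm_pos_iff.2 hx
  have hζ := rpow_le_two_rpow_abs_mul_rpow hx' h₁ h₂ γ
  have hsum : ‖x‖ ≤ ‖ζ - x‖ ∨ ‖x‖ ≤ ‖ζ + x‖ := by
    by_contra! hc
    have h := norm_sub_le (ζ + x) (ζ - x)
    rw [add_sub_sub_cancel, ← two_smul ℝ, norm_smul, Real.norm_two] at h
    linarith
  have hkernel : ‖ζ - x‖ ^ (-α) * ‖ζ + x‖ ^ (-β) ≤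
      ‖x‖ ^ (-β) * ‖ζ - x‖ ^ (-α) + ‖x‖ ^ (-α) * ‖ζ + x‖ ^ (-β) := by
    rcases hsum with h | h
    · have := Real.rpow_le_rpow_of_nonpos hx' h (neg_nonpos.2 hα)
      refine (mul_le_mul_of_nonneg_right this (by positivity)).trans ?_
      exact le_add_of_nonneg_left (by positivity)
    · have := Real.rpow_le_rpow_of_nonpos hx' h (neg_nonpos.2 hβ)
      refine (mul_le_mul_of_nonneg_left this (by positivity)).trans ?_
      rw [mul_comm]
      exact le_add_of_nonneg_right (by positivity)
  refine (mul_le_mul hζ hkernel (by positivity) (by positivity)).trans_eq ?_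
  rw [sub_eq_add_neg γ, sub_eq_add_neg γ, Real.rpow_add hx', Real.rpow_add hx']
  ring

end Kernel

section KernelIntegral

variable {E : Type*} [NormedAddCommGroup E] [NormedSpace ℝ E] [MeasurableSpace E] [BorelSpace E]
  [FiniteDimensional ℝ E] [Nontrivial E] (μ : Measure E) [μ.IsAddHaarMeasure]

theorem exists_integral_kernel_le {α β γ : ℝ} (hα0 : 0 ≤ α) (hα : α < Module.finrank ℝ E)
    (hβ0 : 0 ≤ β) (hβ : β < Module.finrank ℝ E) (hγ : -(Module.finrank ℝ E : ℝ) < γ) :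
    ∃ M L : ℝ, 0 ≤ M ∧ 0 ≤ L ∧ ∀ (x : E) (R : ℝ) (D : Set E), x ≠ 0 → MeasurableSet D →
      D ⊆ Metric.ball 0 R →
      ∫ ζ in D, ‖ζ‖ ^ γ * (‖ζ - x‖ ^ (-α) * ‖ζ + x‖ ^ (-β)) ∂μ ≤
        M * ‖x‖ ^ (Module.finrank ℝ E + γ - α - β) +
          L * ∫ y in Ico (2 * ‖x‖) R, y ^ (Module.finrank ℝ E + γ - α - β - 1) := by
  set d : ℝ := ((Module.finrank ℝ E : ℕ) : ℝ) with hd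
  set c : ℝ := d * μ.real (Metric.ball 0 1) with hc
  have hdα : 0 < d + -α := by linarith
  have hdβ : 0 < d + -β := by linarith
  have hdγ : 0 < d + γ := by linarith
  have hc0 : 0 ≤ c := by positivity
  refine ⟨2 ^ (α + β) * (c * ((1 / 2) ^ (d + γ) / (d + γ))) +
    2 ^ |γ| * (c * (3 ^ (d + -α) / (d + -α))) + 2 ^ |γ| * (c * (3 ^ (d + -β) / (d + -β))),
    2 ^ (α + β) * c, by positivity, by positivity, fun x R D hx hD hDR => ?_⟩
  set r := ‖x‖ with hr
  have hr0 : 0 < r := norm_pos_iff.2 hx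
  let P : ℝ → ℝ → E → ℝ := fun ρ s ζ => (Iio ρ).indicator (fun y => y ^ s) ‖ζ‖
  let Q : E → ℝ := fun ζ => (Ico (2 * r) R).indicator (fun y => y ^ (γ - α - β)) ‖ζ‖
  have hP0 (ρ s : ℝ) (ζ : E) : 0 ≤ P ρ s ζ :=
    indicator_apply_nonneg fun _ => by positivity
  have hQ0 (ζ : E) : 0 ≤ Q ζ := indicator_apply_nonneg fun _ => by positivity
  have hPmem {ρ : ℝ} (s : ℝ) {ζ : E} (h : ‖ζ‖ < ρ) : P ρ s ζ = ‖ζ‖ ^ s :=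
    indicator_of_mem (mem_Iio.2 h) _
  have hIco : Ico (2 * r) R ∩ Ioi 0 = Ico (2 * r) R :=
    inter_eq_left.2 fun y hy => lt_of_lt_of_le (by linarith) hy.1
  have hi₁ : Integrable (P (r / 2) γ) μ := integrable_indicator_Iio_rpow_norm μ hdγ _
  have hi₂ : Integrable (fun ζ => P (3 * r) (-α) (ζ - x)) μ :=
    (integrable_indicator_Iio_rpow_norm μ hdα (3 * r)).comp_sub_right x
  have hi₃ : Integrable (fun ζ => P (3 * r) (-β) (ζ + x)) μ :=
    (integrable_indicator_Iio_rpow_norm μ hdβ (3 * r)).comp_add_right x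
  have hi₄ : Integrable Q μ := by
    refine integrable_indicator_rpow_norm μ measurableSet_Ico ?_
    rw [hIco]
    exact integrableOn_Ico_rpow (by linarith) _ _
  have hv₁ : ∫ ζ, P (r / 2) γ ζ ∂μ = c * ((r / 2) ^ (d + γ) / (d + γ)) :=
    integral_indicator_Iio_rpow_norm μ hdγ (by linarith)
  have hv₂ : ∫ ζ, P (3 * r) (-α) (ζ - x) ∂μ = c * ((3 * r) ^ (d + -α) / (d + -α)) := by
    rw [integral_sub_right_eq_self (P (3 * r) (-α))]
    exact integral_indicator_Iio_rpow_norm μ hdα (by linarith)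
  have hv₃ : ∫ ζ, P (3 * r) (-β) (ζ + x) ∂μ = c * ((3 * r) ^ (d + -β) / (d + -β)) := by
    rw [integral_add_right_eq_self (P (3 * r) (-β))]
    exact integral_indicator_Iio_rpow_norm μ hdβ (by linarith)
  have hv₄ : ∫ ζ, Q ζ ∂μ = c * ∫ y in Ico (2 * r) R, y ^ (d + γ - α - β - 1) := by
    rw [integral_indicator_rpow_norm μ measurableSet_Ico, hIco, ← hd, ← hc]
    ring_nf
  let g : E → ℝ := fun ζ =>
    2 ^ (α + β) * r ^ (-α - β) * P (r / 2) γ ζ +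
    2 ^ |γ| * r ^ (γ - β) * P (3 * r) (-α) (ζ - x) +
    2 ^ |γ| * r ^ (γ - α) * P (3 * r) (-β) (ζ + x) + 2 ^ (α + β) * Q ζ
  have hj₁ := hi₁.const_mul (2 ^ (α + β) * r ^ (-α - β))
  have hj₂ := hi₂.const_mul (2 ^ |γ| * r ^ (γ - β))
  have hj₃ := hi₃.const_mul (2 ^ |γ| * r ^ (γ - α))
  have hj₄ := hi₄.const_mul (2 ^ (α + β))
  have hg : Integrable g μ := ((hj₁.add hj₂).add hj₃).add hj₄
  have hle : ∀ ζ ∈ D, ‖ζ‖ ^ γ * (‖ζ - x‖ ^ (-α) * ‖ζ + x‖ ^ (-β)) ≤ g ζ := by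
    intro ζ hζ
    have hζR : ‖ζ‖ < R := mem_ball_zero_iff.1 (hDR hζ)
    have t₁ : 0 ≤ 2 ^ (α + β) * r ^ (-α - β) * P (r / 2) γ ζ :=
      mul_nonneg (by positivity) (hP0 _ _ _)
    have t₂ : 0 ≤ 2 ^ |γ| * r ^ (γ - β) * P (3 * r) (-α) (ζ - x) :=
      mul_nonneg (by positivity) (hP0 _ _ _)
    have t₃ : 0 ≤ 2 ^ |γ| * r ^ (γ - α) * P (3 * r) (-β) (ζ + x) :=
      mul_nonneg (by positivity) (hP0 _ _ _)
    have t₄ : 0 ≤ 2 ^ (α + β) * Q ζ := mul_nonneg (by positivity) (hQ0 _)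
    rcases lt_or_ge ‖ζ‖ (r / 2) with h | h
    · have hk := kernel_le_of_two_mul_norm_le (γ := γ) hα0 hβ0 hx (by linarith : 2 * ‖ζ‖ ≤ ‖x‖)
      rw [← hPmem γ h] at hk ⊢
      linarith
    rcases lt_or_ge ‖ζ‖ (2 * r) with h' | h'
    · have hk := kernel_le_of_norm_comparable (γ := γ) hα0 hβ0 hx h h'.le
      rw [← hPmem (-α) (by linarith [norm_sub_le ζ x] : ‖ζ - x‖ < 3 * r),
        ← hPmem (-β) (by linarith [norm_add_le ζ x] : ‖ζ + x‖ < 3 * r)] at hk ⊢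
      linarith
    · have hk := kernel_le_of_two_mul_norm_le' (γ := γ) hα0 hβ0 hx h'
      have hQ : Q ζ = ‖ζ‖ ^ (γ - α - β) := indicator_of_mem (mem_Ico.2 ⟨h', hζR⟩) _
      rw [← hQ] at hk
      linarith
  have hg0 (ζ : E) : 0 ≤ g ζ := by
    have := hP0 (r / 2) γ ζ
    have := hP0 (3 * r) (-α) (ζ - x)
    have := hP0 (3 * r) (-β) (ζ + x)
    have := hQ0 ζ
    positivity
  calc _ ≤ ∫ ζ in D, g ζ ∂μ :=
        integral_mono_of_nonneg (ae_of_all _ fun ζ => by positivity) hg.integrableOn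
          (ae_restrict_of_forall_mem hD hle)
    _ ≤ ∫ ζ, g ζ ∂μ := setIntegral_le_integral hg (ae_of_all _ hg0)
    _ = 2 ^ (α + β) * r ^ (-α - β) * (c * ((r / 2) ^ (d + γ) / (d + γ))) +
        2 ^ |γ| * r ^ (γ - β) * (c * ((3 * r) ^ (d + -α) / (d + -α))) +
        2 ^ |γ| * r ^ (γ - α) * (c * ((3 * r) ^ (d + -β) / (d + -β))) +
        2 ^ (α + β) * (c * ∫ y in Ico (2 * r) R, y ^ (d + γ - α - β - 1)) := by
      rw [← hv₁, ← hv₂, ← hv₃, ← hv₄]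
      simp only [← integral_const_mul]
      rw [← integral_add hj₁ hj₂, ← integral_add (hj₁.fun_add hj₂) hj₃,
        ← integral_add ((hj₁.fun_add hj₂).fun_add hj₃) hj₄]
    _ = _ := by
      have e₁ : r ^ (d + γ - α - β) = r ^ (-α - β) * r ^ (d + γ) := by
        rw [← Real.rpow_add hr0]
        ring_nf
      have e₂ : r ^ (d + γ - α - β) = r ^ (γ - β) * r ^ (d + -α) := by
        rw [← Real.rpow_add hr0]
        ring_nf
      have e₃ : r ^ (d + γ - α - β) = r ^ (γ - α) * r ^ (d + -β) := by
        rw [← Real.rpow_add hr0]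
        ring_nf
      have e₄ : (r / 2) ^ (d + γ) = (1 / 2) ^ (d + γ) * r ^ (d + γ) := by
        rw [← Real.mul_rpow (by norm_num) hr0.le]
        ring_nf
      rw [add_mul, add_mul]
      nth_rewrite 1 [e₁]
      nth_rewrite 1 [e₂]
      rw [e₃, e₄, Real.mul_rpow (by norm_num) hr0.le, Real.mul_rpow (by norm_num) hr0.le]
      ring

theorem integral_kernel_le_of_two_mul_le_norm {α β γ : ℝ} (hα0 : 0 ≤ α) (hβ0 : 0 ≤ β)
    (hγ : -(Module.finrank ℝ E : ℝ) < γ) {x : E} {R : ℝ} (hR : 0 < R) (hx : 2 * R ≤ ‖x‖)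
    {D : Set E} (hD : MeasurableSet D) (hDR : D ⊆ Metric.ball 0 R) :
    ∫ ζ in D, ‖ζ‖ ^ γ * (‖ζ - x‖ ^ (-α) * ‖ζ + x‖ ^ (-β)) ∂μ ≤
      2 ^ (α + β) * (2 * R) ^ (-α - β) *
        ∫ ζ : E, (Iio R).indicator (fun y => y ^ γ) ‖ζ‖ ∂μ := by
  have hx0 : x ≠ 0 := norm_pos_iff.1 (by linarith)
  have hi := (integrable_indicator_Iio_rpow_norm μ (by linarith : 0 < Module.finrank ℝ E + γ)
    R).const_mul (2 ^ (α + β) * (2 * R) ^ (-α - β))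
  rw [← integral_const_mul]
  refine (integral_mono_of_nonneg (ae_of_all _ fun ζ => by positivity) hi.integrableOn
    (ae_restrict_of_forall_mem hD fun ζ hζ => ?_)).trans
    (setIntegral_le_integral hi (ae_of_all _ fun ζ => ?_))
  · have hζR : ‖ζ‖ < R := mem_ball_zero_iff.1 (hDR hζ)
    refine (kernel_le_of_two_mul_norm_le hα0 hβ0 hx0 (by linarith)).trans ?_
    simp only [indicator_of_mem (mem_Iio.2 hζR)]
    have := Real.rpow_le_rpow_of_nonpos (by linarith) hx (by linarith : -α - β ≤ 0)
    gcongr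
  · exact mul_nonneg (by positivity) (indicator_apply_nonneg fun _ => by positivity)

theorem exists_kernel_integral_bound {α β γ : ℝ} (hα0 : 0 ≤ α) (hα : α < Module.finrank ℝ E)
    (hβ0 : 0 ≤ β) (hβ : β < Module.finrank ℝ E) (hγ : -(Module.finrank ℝ E : ℝ) < γ)
    {D : Set E} (hD : MeasurableSet D) (hDb : Bornology.IsBounded D) :
    ∃ C : ℝ, 0 < C ∧ ∀ x : E, x ≠ 0 →
      (α + β < Module.finrank ℝ E + γ →
        ∫ ζ in D, ‖ζ‖ ^ γ * (‖ζ - x‖ ^ (-α) * ‖ζ + x‖ ^ (-β)) ∂μ ≤ C) ∧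
      (α + β = Module.finrank ℝ E + γ →
        ∫ ζ in D, ‖ζ‖ ^ γ * (‖ζ - x‖ ^ (-α) * ‖ζ + x‖ ^ (-β)) ∂μ ≤
          C * (1 + |Real.log ‖x‖|)) ∧
      (Module.finrank ℝ E + γ < α + β →
        ∫ ζ in D, ‖ζ‖ ^ γ * (‖ζ - x‖ ^ (-α) * ‖ζ + x‖ ^ (-β)) ∂μ ≤
          C * ‖x‖ ^ (Module.finrank ℝ E + γ - α - β)) := by
  obtain ⟨R, hR, hDR⟩ := hDb.subset_ball_lt 0 0
  obtain ⟨M, L, hM, hL, hML⟩ := exists_integral_kernel_le μ hα0 hα hβ0 hβ hγ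
  set d : ℝ := ((Module.finrank ℝ E : ℕ) : ℝ) with hd
  set t := d + γ - α - β with ht
  rcases lt_trichotomy (α + β) (d + γ) with h | h | h
  · have htpos : 0 < t := by linarith
    set I : ℝ := 2 ^ (α + β) * (2 * R) ^ (-α - β) *
      ∫ ζ : E, (Iio R).indicator (fun y => y ^ γ) ‖ζ‖ ∂μ
    have hI : 0 ≤ I := mul_nonneg (by positivity)
      (integral_nonneg fun ζ => indicator_apply_nonneg fun _ => by positivity)
    refine ⟨M * (2 * R) ^ t + L * (R ^ t / t) + I + 1, by positivity, fun x hx =>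
      ⟨fun _ => ?_, fun h' => absurd h' h.ne, fun h' => absurd h' h.not_gt⟩⟩
    have hx' := norm_pos_iff.2 hx
    rcases le_total (2 * R) ‖x‖ with hxR | hxR
    · refine (integral_kernel_le_of_two_mul_le_norm μ hα0 hβ0 hγ hR hxR hD hDR).trans ?_
      have : 0 ≤ M * (2 * R) ^ t + L * (R ^ t / t) := by positivity
      linarith
    · have h₁ := hML x R D hx hD hDR
      have h₂ : M * ‖x‖ ^ t ≤ M * (2 * R) ^ t := by gcongr
      have h₃ := mul_le_mul_of_nonneg_left
        (integral_Ico_rpow_le_of_pos (by linarith : 0 < 2 * ‖x‖) hR.le htpos) hL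
      linarith
  · have ht0 : t = 0 := by linarith
    refine ⟨M + L * (1 + Real.log 2 + |Real.log R|) + 1, by positivity, fun x hx =>
      ⟨fun h' => absurd h h'.ne, fun _ => ?_, fun h' => absurd h h'.ne'⟩⟩
    have hx' := norm_pos_iff.2 hx
    have h₁ := hML x R D hx hD hDR
    rw [ht0, Real.rpow_zero, zero_sub] at h₁
    have h₂ := integral_Ico_rpow_neg_one_le (by linarith : 0 < 2 * ‖x‖) hR
    rw [Real.log_mul two_ne_zero hx'.ne'] at h₂
    have hlog2 : 0 ≤ Real.log 2 := by positivity
    have h₃ := abs_add_le (Real.log 2) (Real.log ‖x‖)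
    rw [abs_of_nonneg hlog2] at h₃
    have h₄ := mul_le_mul_of_nonneg_left
      (h₂.trans (by linarith : _ ≤ Real.log 2 + |Real.log ‖x‖| + |Real.log R|)) hL
    have h₅ : 0 ≤ (M + L * (Real.log 2 + |Real.log R|) + 1) * |Real.log ‖x‖| := by positivity
    nlinarith
  · have htneg : t < 0 := by linarith
    have hnt : 0 < -t := by linarith
    refine ⟨M + L * (2 ^ t / (-t)) + 1, by positivity, fun x hx =>
      ⟨fun h' => absurd h' h.not_gt, fun h' => absurd h' h.ne', fun _ => ?_⟩⟩
    have hx' := norm_pos_iff.2 hx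
    have h₁ := hML x R D hx hD hDR
    have h₂ := mul_le_mul_of_nonneg_left
      (integral_Ico_rpow_le_of_neg (b := R) (by linarith : 0 < 2 * ‖x‖) htneg) hL
    rw [Real.mul_rpow zero_le_two hx'.le] at h₂
    have h₃ : 0 ≤ ‖x‖ ^ t := by positivity
    calc _ ≤ M * ‖x‖ ^ t + L * (2 ^ t * ‖x‖ ^ t / -t) := by linarith
      _ = (M + L * (2 ^ t / (-t))) * ‖x‖ ^ t := by ring
      _ ≤ _ := mul_le_mul_of_nonneg_right (by linarith) h₃

end KernelIntegral

end

theorem finrank_real_euclideanSpace_complex (n : ℕ) :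
    Module.finrank ℝ (EuclideanSpace ℂ (Fin n)) = 2 * n := by
  have h := finrank_real_of_complex (EuclideanSpace ℂ (Fin n))
  rwa [finrank_euclideanSpace_fin] at h

theorem stmt7 (n : ℕ) (D : Set (EuclideanSpace ℂ (Fin n))) (hDo : IsOpen D)
    (hDb : Bornology.IsBounded D) (α β γ : ℝ) (hα0 : 0 ≤ α) (hα : α < 2 * n)
    (hβ0 : 0 ≤ β) (hβ : β < 2 * n) (hγ : -(2 * (n : ℝ)) < γ) :
    ∃ C : ℝ, 0 < C ∧ ∀ x : EuclideanSpace ℂ (Fin n), x ≠ 0 →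
      (α + β < 2 * n + γ →
        ∫ ζ in D, ‖ζ‖ ^ γ * (‖ζ - x‖ ^ (-α) * ‖ζ + x‖ ^ (-β)) ≤ C) ∧
      (α + β = 2 * n + γ →
        ∫ ζ in D, ‖ζ‖ ^ γ * (‖ζ - x‖ ^ (-α) * ‖ζ + x‖ ^ (-β)) ≤
          C * (1 + |Real.log ‖x‖|)) ∧
      (2 * (n : ℝ) + γ < α + β →
        ∫ ζ in D, ‖ζ‖ ^ γ * (‖ζ - x‖ ^ (-α) * ‖ζ + x‖ ^ (-β)) ≤
          C * ‖x‖ ^ (2 * (n : ℝ) + γ - α - β)) := by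
  have hfin := finrank_real_euclideanSpace_complex n
  have hn : 0 < n := by
    have : (0 : ℝ) < 2 * n := hα0.trans_lt hα
    exact_mod_cast (by linarith : (0 : ℝ) < n)
  have : NeZero n := ⟨hn.ne'⟩
  have hfin' : (Module.finrank ℝ (EuclideanSpace ℂ (Fin n)) : ℝ) = 2 * n := by
    rw [hfin]
    push_cast
    rfl
  have key := exists_kernel_integral_bound (volume : Measure (EuclideanSpace ℂ (Fin n)))
    (α := α) (β := β) (γ := γ) hα0 (by rwa [hfin']) hβ0 (by rwa [hfin']) (by rwa [hfin'])
    hDo.measurableSet hDb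
  rwa [hfin'] at key
end

section
/- Let $n \geq 2$, $0 \leq \gamma \leq 6$, and $0 \leq \alpha, \beta < 2n$ with $\alpha + \beta = 2n + 2$. Set $\epsilon_k = e^{-e^k/2}$. There exists $C > 0$ such that for all $x \in \mathbb{C}^n$ and all integers $k \geq 1$: $\|x\|^{6-\gamma} \int_{B_{\epsilon_{k-1}}(0) \setminus \overline{B_{\epsilon_{k+1}}(0)}} \frac{\|\zeta\|^{\gamma-4}}{\|\zeta-x\|^{\alpha}\,\|\zeta+x\|^{\beta}\,|\log\|\zeta\||}\, dV(\zeta) \leq C$. -/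
open MeasureTheory

section RadialEstimates

open Set

lemma inv_rpow_mul_rpow_le {y p q α β : ℝ} (hy : 0 < y) (hp : y ≤ p) (hq : y ≤ q)
    (hα : 0 ≤ α) (hβ : 0 ≤ β) : (p ^ α * q ^ β)⁻¹ ≤ y ^ (-(α + β)) := by
  rw [Real.rpow_neg hy.le, Real.rpow_add hy]
  have : 0 ≤ p := hy.le.trans hp
  gcongr

lemma inv_rpow_mul_rpow_le_add {X p q α β : ℝ} (hX : 0 < X) (hp : 0 ≤ p) (hq : 0 ≤ q)
    (hpq : 2 * X ≤ p + q) (hα : 0 ≤ α) (hβ : 0 ≤ β) :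
    (p ^ α * q ^ β)⁻¹ ≤ X ^ (-α) * q ^ (-β) + X ^ (-β) * p ^ (-α) := by
  rw [mul_inv, ← Real.rpow_neg hp, ← Real.rpow_neg hq]
  rcases le_total X p with h | h
  · have : p ^ (-α) ≤ X ^ (-α) := Real.rpow_le_rpow_of_nonpos hX h (by linarith)
    calc p ^ (-α) * q ^ (-β) ≤ X ^ (-α) * q ^ (-β) := by gcongr
      _ ≤ _ := le_add_of_nonneg_right (by positivity)
  · have : q ^ (-β) ≤ X ^ (-β) :=
      Real.rpow_le_rpow_of_nonpos hX (by linarith) (by linarith)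
    calc p ^ (-α) * q ^ (-β) ≤ p ^ (-α) * X ^ (-β) := by gcongr
      _ = X ^ (-β) * p ^ (-α) := mul_comm _ _
      _ ≤ _ := le_add_of_nonneg_left (by positivity)

lemma rpow_le_sixteen_mul_rpow {X r s : ℝ} (hX : 0 < X) (hr : X / 2 ≤ r) (hr' : r ≤ 2 * X)
    (hs : -4 ≤ s) (hs' : s ≤ 4) : r ^ s ≤ 16 * X ^ s := by
  have h16 : (16 : ℝ) = 2 ^ (4 : ℝ) := by norm_num
  have hr0 : 0 < r := by linarith
  rcases le_total 0 s with h | h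
  · calc r ^ s ≤ (2 * X) ^ s := by gcongr
      _ = 2 ^ s * X ^ s := Real.mul_rpow (by norm_num) hX.le
      _ ≤ 2 ^ (4 : ℝ) * X ^ s := by gcongr; norm_num
      _ = _ := by rw [h16]
  · calc r ^ s ≤ (X / 2) ^ s := Real.rpow_le_rpow_of_nonpos (by positivity) hr h
      _ = 2 ^ (-s) * X ^ s := by
        rw [Real.div_rpow hX.le (by norm_num), Real.rpow_neg (by norm_num)]; field_simp
      _ ≤ 2 ^ (4 : ℝ) * X ^ s := by gcongr <;> linarith
      _ = _ := by rw [h16]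

lemma kernel_le {d X r p q L γ α β : ℝ} (hd : 4 ≤ d) (hγ0 : 0 ≤ γ) (hγ6 : γ ≤ 6)
    (hα : 0 ≤ α) (hβ : 0 ≤ β) (hsum : α + β = d + 2) (hX : 0 ≤ X) (hr : 0 < r)
    (hp : |r - X| ≤ p) (hq : |r - X| ≤ q) (hp' : p ≤ r + X) (hq' : q ≤ r + X)
    (hpq : 2 * X ≤ p + q) (hL : 1 / 2 ≤ L) :
    X ^ (6 - γ) * (r ^ (γ - 4) / (p ^ α * q ^ β * L)) ≤
      2 ^ (d + 2) * (r ^ (-d) / L) +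
        (32 * X ^ (2 - α) * (if q < 3 * X then q ^ (-β) else 0) +
          32 * X ^ (2 - β) * (if p < 3 * X then p ^ (-α) else 0)) := by
  have hp0 : 0 ≤ p := (abs_nonneg _).trans hp
  have hq0 : 0 ≤ q := (abs_nonneg _).trans hq
  have hL0 : 0 < L := by linarith
  have hnn : 0 ≤ 32 * X ^ (2 - α) * (if q < 3 * X then q ^ (-β) else 0) +
      32 * X ^ (2 - β) * (if p < 3 * X then p ^ (-α) else 0) := by
    split_ifs <;> positivity
  have hfar : ∀ y : ℝ, 0 < y → y / 2 ≤ |r - X| →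
      X ^ (6 - γ) * r ^ (γ - 4) * y ^ (-(d + 2)) ≤ r ^ (-d) →
      X ^ (6 - γ) * (r ^ (γ - 4) / (p ^ α * q ^ β * L)) ≤ 2 ^ (d + 2) * (r ^ (-d) / L) := by
    intro y hy hyr hle
    have h1 := inv_rpow_mul_rpow_le (half_pos hy) (hyr.trans hp) (hyr.trans hq) hα hβ
    have h2 : (y / 2) ^ (-(α + β)) = 2 ^ (d + 2) * y ^ (-(d + 2)) := by
      rw [hsum, Real.div_rpow hy.le (by norm_num), Real.rpow_neg (x := 2) (by norm_num)]
      field_simp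
    calc X ^ (6 - γ) * (r ^ (γ - 4) / (p ^ α * q ^ β * L))
        = X ^ (6 - γ) * r ^ (γ - 4) * (p ^ α * q ^ β)⁻¹ / L := by
          simp only [div_eq_mul_inv, mul_inv]; ring
      _ ≤ X ^ (6 - γ) * r ^ (γ - 4) * (2 ^ (d + 2) * y ^ (-(d + 2))) / L := by
          rw [← h2]; gcongr
      _ = 2 ^ (d + 2) * (X ^ (6 - γ) * r ^ (γ - 4) * y ^ (-(d + 2)) / L) := by ring
      _ ≤ _ := by gcongr
  rcases le_or_gt (2 * X) r with hhigh | hhigh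
  · refine (hfar r hr (by rw [abs_of_nonneg] <;> linarith) ?_).trans (le_add_of_nonneg_right hnn)
    calc X ^ (6 - γ) * r ^ (γ - 4) * r ^ (-(d + 2))
        ≤ r ^ (6 - γ) * r ^ (γ - 4) * r ^ (-(d + 2)) := by
          gcongr
          linarith
      _ = r ^ (-d) := by
          rw [← Real.rpow_add hr, ← Real.rpow_add hr]; ring_nf
  have hX0 : 0 < X := by linarith
  rcases le_or_gt r (X / 2) with hlow | hlow
  · refine (hfar X hX0 (by rw [abs_of_nonpos] <;> linarith) ?_).trans
      (le_add_of_nonneg_right hnn)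
    calc X ^ (6 - γ) * r ^ (γ - 4) * X ^ (-(d + 2))
        = X ^ (-(γ - 4 + d)) * r ^ (γ - 4) := by
          rw [mul_right_comm, ← Real.rpow_add hX0]; ring_nf
      _ ≤ r ^ (-(γ - 4 + d)) * r ^ (γ - 4) := by
          gcongr ?_ * _
          exact Real.rpow_le_rpow_of_nonpos hr (by linarith) (by linarith)
      _ = r ^ (-d) := by rw [← Real.rpow_add hr]; ring_nf
  · rw [if_pos (by linarith), if_pos (by linarith)]
    refine le_trans ?_ (le_add_of_nonneg_left (by positivity))
    have h1 := inv_rpow_mul_rpow_le_add hX0 hp0 hq0 hpq hα hβ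
    have h2 : r ^ (γ - 4) ≤ 16 * X ^ (γ - 4) :=
      rpow_le_sixteen_mul_rpow hX0 hlow.le hhigh.le (by linarith) (by linarith)
    have h3 : L⁻¹ ≤ 2 := inv_le_of_inv_le₀ (by norm_num) (by linarith)
    calc X ^ (6 - γ) * (r ^ (γ - 4) / (p ^ α * q ^ β * L))
        = X ^ (6 - γ) * (r ^ (γ - 4) * ((p ^ α * q ^ β)⁻¹ * L⁻¹)) := by
          simp only [div_eq_mul_inv, mul_inv]
      _ ≤ X ^ (6 - γ) * (16 * X ^ (γ - 4) *
          ((X ^ (-α) * q ^ (-β) + X ^ (-β) * p ^ (-α)) * 2)) := by gcongr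
      _ = 32 * ((X ^ (6 - γ) * X ^ (γ - 4) * X ^ (-α)) * q ^ (-β) +
          (X ^ (6 - γ) * X ^ (γ - 4) * X ^ (-β)) * p ^ (-α)) := by ring
      _ = _ := by
          simp only [← Real.rpow_add hX0]; ring_nf

variable {E : Type*} [NormedAddCommGroup E] [NormedSpace ℝ E] [FiniteDimensional ℝ E]
  [Nontrivial E] [MeasurableSpace E] [BorelSpace E] (μ : Measure E) [μ.IsAddHaarMeasure]

lemma setIntegral_annulus_div_log {a b : ℝ} (ha : 0 < a) (hab : a ≤ b) (hb : b < 1) :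
    IntegrableOn (fun ζ : E => ‖ζ‖ ^ (-(Module.finrank ℝ E : ℝ)) / |Real.log ‖ζ‖|)
      (Metric.ball 0 b \ Metric.closedBall 0 a) μ ∧
    ∫ ζ in Metric.ball (0 : E) b \ Metric.closedBall 0 a,
      ‖ζ‖ ^ (-(Module.finrank ℝ E : ℝ)) / |Real.log ‖ζ‖| ∂μ =
      Module.finrank ℝ E * μ.real (Metric.ball 0 1) *
        (Real.log (-Real.log a) - Real.log (-Real.log b)) := by
  have hS : MeasurableSet (Metric.ball (0 : E) b \ Metric.closedBall 0 a) :=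
    measurableSet_ball.diff measurableSet_closedBall
  set d := Module.finrank ℝ E with hd
  have hdpos : 0 < d := Module.finrank_pos
  let f : ℝ → ℝ := (Ioo a b).indicator fun r => r ^ (-(d : ℝ)) / |Real.log r|
  have hf : (Metric.ball (0 : E) b \ Metric.closedBall 0 a).indicator
      (fun ζ : E => ‖ζ‖ ^ (-(d : ℝ)) / |Real.log ‖ζ‖|) = fun ζ => f ‖ζ‖ := by
    ext ζ
    simp only [f, indicator, mem_sdiff, mem_ball_zero_iff, mem_closedBall_zero_iff, not_le, mem_Ioo,
      and_comm]
  have hrad : EqOn (fun y : ℝ => y ^ (d - 1) • f y)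
      ((Ioo a b).indicator fun r => (r * -Real.log r)⁻¹) (Ioi 0) := by
    intro y hy
    by_cases h : y ∈ Ioo a b
    · have hy0 : 0 < y := hy
      have hlog : Real.log y < 0 := Real.log_neg hy0 (h.2.trans hb)
      simp only [f, indicator_of_mem h, smul_eq_mul, abs_of_neg hlog]
      rw [Real.rpow_neg hy0.le, Real.rpow_natCast]
      obtain ⟨m, hm⟩ : ∃ m, d = m + 1 := ⟨d - 1, by omega⟩
      rw [hm, Nat.add_sub_cancel, pow_succ]
      have := hlog.ne
      field_simp
    · simp [f, indicator_of_notMem h]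
  have hlogneg : ∀ y ∈ Icc a b, Real.log y < 0 := fun y hy =>
    Real.log_neg (ha.trans_le hy.1) (hy.2.trans_lt hb)
  have hcont : ContinuousOn (fun r : ℝ => (r * -Real.log r)⁻¹) (Icc a b) := by
    refine ContinuousOn.inv₀ (continuousOn_id.mul (ContinuousOn.neg
      (Real.continuousOn_log.mono fun y hy => (ha.trans_le hy.1).ne'))) fun y hy => ?_
    exact mul_ne_zero (ha.trans_le hy.1).ne' (neg_ne_zero.2 (hlogneg y hy).ne)
  have hsub : Ioo a b ⊆ Ioi 0 := fun y hy => ha.trans hy.1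
  rw [← integrable_indicator_iff hS, ← integral_indicator hS, hf, integrable_fun_norm_addHaar μ,
    integral_fun_norm_addHaar μ, setIntegral_congr_fun measurableSet_Ioi hrad,
    integrableOn_congr_fun hrad measurableSet_Ioi, setIntegral_indicator measurableSet_Ioo,
    inter_eq_self_of_subset_right hsub, ← integral_Ioc_eq_integral_Ioo,
    ← intervalIntegral.integral_of_le hab]
  constructor
  · exact ((hcont.integrableOn_Icc.mono_set Ioo_subset_Icc_self).integrable_indicator
      measurableSet_Ioo).integrableOn
  · have hF : ∫ y in a..b, (y * -Real.log y)⁻¹ =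
        -Real.log (-Real.log b) - -Real.log (-Real.log a) := by
      refine intervalIntegral.integral_eq_sub_of_hasDerivAt
        (f := fun y => -Real.log (-Real.log y)) (fun y hy => ?_)
        (ContinuousOn.intervalIntegrable (by rwa [uIcc_of_le hab]))
      rw [uIcc_of_le hab] at hy
      have h0 := (ha.trans_le hy.1).ne'
      have h1 := (hlogneg y hy).ne
      refine ((Real.hasDerivAt_log h0).fun_neg.log (neg_ne_zero.2 h1)).fun_neg.congr_deriv ?_
      field_simp
    rw [hF]
    simp only [nsmul_eq_mul, smul_eq_mul]
    ring

lemma setIntegral_ball_norm_rpow_neg {s R : ℝ} (hs : s < Module.finrank ℝ E) (hR : 0 ≤ R)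
    (x : E) :
    IntegrableOn (fun ζ : E => ‖ζ - x‖ ^ (-s)) (Metric.ball x R) μ ∧
    ∫ ζ in Metric.ball x R, ‖ζ - x‖ ^ (-s) ∂μ =
      Module.finrank ℝ E * μ.real (Metric.ball 0 1) *
        (R ^ (Module.finrank ℝ E - s) / (Module.finrank ℝ E - s)) := by
  set d := Module.finrank ℝ E with hd
  have hdpos : 0 < d := Module.finrank_pos
  let f : ℝ → ℝ := (Iio R).indicator fun r => r ^ (-s)
  have hf : (Metric.ball x R).indicator (fun ζ : E => ‖ζ - x‖ ^ (-s)) =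
      fun ζ => f ‖ζ - x‖ := by
    ext ζ
    simp only [f, indicator, mem_ball_iff_norm, mem_Iio]
  have hrad : EqOn (fun y : ℝ => y ^ (d - 1) • f y)
      ((Iio R).indicator fun r => r ^ (d - 1 - s)) (Ioi 0) := by
    intro y hy
    have hy0 : 0 < y := hy
    by_cases h : y ∈ Iio R
    · simp only [f, indicator_of_mem h, smul_eq_mul]
      rw [← Real.rpow_natCast, ← Real.rpow_add hy0, Nat.cast_pred hdpos, sub_eq_add_neg _ s]
    · simp [f, indicator_of_notMem h]
  have hexp : -1 < (d : ℝ) - 1 - s := by linarith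
  rw [← integrable_indicator_iff measurableSet_ball, ← integral_indicator measurableSet_ball, hf,
    integral_sub_right_eq_self (fun ζ => f ‖ζ‖) x, integral_fun_norm_addHaar μ,
    setIntegral_congr_fun measurableSet_Ioi hrad, setIntegral_indicator measurableSet_Iio,
    Ioi_inter_Iio, ← integral_Ioc_eq_integral_Ioo, ← intervalIntegral.integral_of_le hR,
    integral_rpow (Or.inl hexp)]
  constructor
  · refine Integrable.comp_sub_right (f := fun ζ => f ‖ζ‖) ?_ x
    rw [integrable_fun_norm_addHaar μ, integrableOn_congr_fun hrad measurableSet_Ioi]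
    rw [IntegrableOn, integrable_indicator_iff measurableSet_Iio, IntegrableOn,
      Measure.restrict_restrict measurableSet_Iio, inter_comm, Ioi_inter_Iio]
    exact ((intervalIntegrable_iff_integrableOn_Ioc_of_le hR).1
      (intervalIntegral.intervalIntegrable_rpow' hexp)).mono_set Ioo_subset_Ioc_self
  · rw [Real.zero_rpow (by linarith)]
    simp only [nsmul_eq_mul, smul_eq_mul, sub_zero, ← hd]
    rw [show (d : ℝ) - 1 - s + 1 = d - s by ring]
    ring

theorem rpow_mul_setIntegral_annulus_le {γ α β : ℝ} (hd : 4 ≤ Module.finrank ℝ E)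
    (hγ0 : 0 ≤ γ) (hγ6 : γ ≤ 6) (hα0 : 0 ≤ α) (hα : α < Module.finrank ℝ E) (hβ0 : 0 ≤ β)
    (hβ : β < Module.finrank ℝ E) (hsum : α + β = Module.finrank ℝ E + 2) {a b : ℝ} (ha : 0 < a)
    (hab : a ≤ b) (hb : b ≤ Real.exp (-1 / 2)) (x : E) :
    ‖x‖ ^ (6 - γ) * ∫ ζ in Metric.ball (0 : E) b \ Metric.closedBall 0 a,
        ‖ζ‖ ^ (γ - 4) / (‖ζ - x‖ ^ α * ‖ζ + x‖ ^ β * |Real.log ‖ζ‖|) ∂μ ≤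
      Module.finrank ℝ E * μ.real (Metric.ball 0 1) *
        (2 ^ (Module.finrank ℝ E + 2 : ℝ) * (Real.log (-Real.log a) - Real.log (-Real.log b)) +
          32 * (3 ^ (Module.finrank ℝ E - β) / (Module.finrank ℝ E - β)) +
          32 * (3 ^ (Module.finrank ℝ E - α) / (Module.finrank ℝ E - α))) := by
  have hb1 : b < 1 := hb.trans_lt (by norm_num)
  obtain ⟨hAint, hA⟩ := setIntegral_annulus_div_log μ ha hab hb1
  have hR : 0 ≤ 3 * ‖x‖ := by positivity
  obtain ⟨hPint, hP⟩ := setIntegral_ball_norm_rpow_neg μ hα hR x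
  obtain ⟨hQint, hQ⟩ := setIntegral_ball_norm_rpow_neg μ hβ hR (-x)
  simp only [sub_neg_eq_add] at hQint hQ
  set d := Module.finrank ℝ E
  have hd' : (4 : ℝ) ≤ d := by exact_mod_cast hd
  set S := Metric.ball (0 : E) b \ Metric.closedBall 0 a
  have hS : MeasurableSet S := measurableSet_ball.diff measurableSet_closedBall
  set P : E → ℝ := (Metric.ball x (3 * ‖x‖)).indicator fun ζ => ‖ζ - x‖ ^ (-α) with hPdef
  set Q : E → ℝ := (Metric.ball (-x) (3 * ‖x‖)).indicator fun ζ => ‖ζ + x‖ ^ (-β) with hQdef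
  rw [← integrable_indicator_iff measurableSet_ball] at hPint hQint
  rw [← hPdef] at hPint
  rw [← hQdef] at hQint
  rw [← integral_indicator measurableSet_ball] at hP hQ
  have hP0 : 0 ≤ P := indicator_nonneg fun _ _ => by positivity
  have hQ0 : 0 ≤ Q := indicator_nonneg fun _ _ => by positivity
  have hpt : ∀ ζ ∈ S,
      ‖x‖ ^ (6 - γ) * (‖ζ‖ ^ (γ - 4) / (‖ζ - x‖ ^ α * ‖ζ + x‖ ^ β * |Real.log ‖ζ‖|)) ≤
        2 ^ (d + 2 : ℝ) * (‖ζ‖ ^ (-(d : ℝ)) / |Real.log ‖ζ‖|) +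
          (32 * ‖x‖ ^ (2 - α) * Q ζ + 32 * ‖x‖ ^ (2 - β) * P ζ) := by
    intro ζ hζ
    simp only [S, mem_sdiff, mem_ball_zero_iff, mem_closedBall_zero_iff, not_le] at hζ
    have hζ0 : 0 < ‖ζ‖ := ha.trans hζ.2
    have hlog : Real.log ‖ζ‖ ≤ -1 / 2 :=
      (Real.log_le_iff_le_exp hζ0).2 (hζ.1.le.trans hb)
    have htri : 2 * ‖x‖ ≤ ‖ζ - x‖ + ‖ζ + x‖ := by
      have h := norm_sub_le (ζ + x) (ζ - x)
      rw [show ζ + x - (ζ - x) = (2 : ℝ) • x by rw [two_smul]; abel, norm_smul] at h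
      norm_num at h
      linarith
    have habs : |‖ζ‖ - ‖x‖| ≤ ‖ζ + x‖ := by
      simpa using abs_norm_sub_norm_le ζ (-x)
    have h := kernel_le hd' hγ0 hγ6 hα0 hβ0 hsum (norm_nonneg x) hζ0 (abs_norm_sub_norm_le ζ x)
      habs (norm_sub_le ζ x) (norm_add_le ζ x) htri
      (L := |Real.log ‖ζ‖|) (by rw [abs_of_neg] <;> linarith)
    simpa only [hPdef, hQdef, indicator, mem_ball_iff_norm, sub_neg_eq_add] using h
  have hscale : ∀ s t : ℝ, t < d → s + t = d + 2 →
      32 * ‖x‖ ^ (2 - s) * (d * μ.real (Metric.ball 0 1) * ((3 * ‖x‖) ^ (d - t) / (d - t))) ≤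
        d * μ.real (Metric.ball 0 1) * (32 * (3 ^ (d - t) / (d - t))) := by
    intro s t ht hst
    have hdt : 0 < d - t := by linarith
    have hone : ‖x‖ ^ (2 - s) * ‖x‖ ^ (d - t) ≤ 1 := by
      rcases (norm_nonneg x).eq_or_lt with h | h
      · rw [← h, Real.zero_rpow hdt.ne', mul_zero]
        exact zero_le_one
      · rw [← Real.rpow_add h, show 2 - s + (d - t) = 0 by linarith, Real.rpow_zero]
    rw [Real.mul_rpow (by norm_num) (norm_nonneg x)]
    calc _ = d * μ.real (Metric.ball 0 1) * (32 * (3 ^ (d - t) / (d - t))) *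
          (‖x‖ ^ (2 - s) * ‖x‖ ^ (d - t)) := by ring
      _ ≤ _ := mul_le_of_le_one_right (by positivity) hone
  have hQS : ∫ ζ in S, Q ζ ∂μ ≤ ∫ ζ, Q ζ ∂μ :=
    setIntegral_le_integral hQint (Filter.Eventually.of_forall hQ0)
  have hPS : ∫ ζ in S, P ζ ∂μ ≤ ∫ ζ, P ζ ∂μ :=
    setIntegral_le_integral hPint (Filter.Eventually.of_forall hP0)
  have hA' := hAint.const_mul (2 ^ (d + 2 : ℝ))
  have hQ' := hQint.integrableOn (s := S) |>.const_mul (32 * ‖x‖ ^ (2 - α))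
  have hP' := hPint.integrableOn (s := S) |>.const_mul (32 * ‖x‖ ^ (2 - β))
  rw [← integral_const_mul]
  calc _ ≤ ∫ ζ in S, (2 ^ (d + 2 : ℝ) * (‖ζ‖ ^ (-(d : ℝ)) / |Real.log ‖ζ‖|) +
          (32 * ‖x‖ ^ (2 - α) * Q ζ + 32 * ‖x‖ ^ (2 - β) * P ζ)) ∂μ := by
        refine integral_mono_of_nonneg (Filter.Eventually.of_forall fun ζ => by positivity)
          (hA'.add (hQ'.add hP')) ?_
        exact (ae_restrict_iff' hS).2 (Filter.Eventually.of_forall hpt)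
    _ = 2 ^ (d + 2 : ℝ) * (∫ ζ in S, ‖ζ‖ ^ (-(d : ℝ)) / |Real.log ‖ζ‖| ∂μ) +
          (32 * ‖x‖ ^ (2 - α) * (∫ ζ in S, Q ζ ∂μ) +
            32 * ‖x‖ ^ (2 - β) * ∫ ζ in S, P ζ ∂μ) := by
        rw [integral_add hA' (hQ'.fun_add hP'), integral_add hQ' hP']
        simp only [integral_const_mul]
    _ ≤ 2 ^ (d + 2 : ℝ) * (∫ ζ in S, ‖ζ‖ ^ (-(d : ℝ)) / |Real.log ‖ζ‖| ∂μ) +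
          (32 * ‖x‖ ^ (2 - α) * (∫ ζ, Q ζ ∂μ) + 32 * ‖x‖ ^ (2 - β) * ∫ ζ, P ζ ∂μ) := by
        gcongr
    _ ≤ _ := by
        rw [hA, hP, hQ]
        have h1 := hscale α β hβ hsum
        have h2 := hscale β α hα (by linarith)
        linear_combination h1 + h2

end RadialEstimates

theorem stmt8 (n : ℕ) (hn : 2 ≤ n) (γ α β : ℝ) (hγ0 : 0 ≤ γ) (hγ6 : γ ≤ 6)
    (hα0 : 0 ≤ α) (hα : α < 2 * n) (hβ0 : 0 ≤ β) (hβ : β < 2 * n)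
    (hsum : α + β = 2 * n + 2) :
    ∃ C : ℝ, 0 < C ∧ ∀ (x : EuclideanSpace ℂ (Fin n)) (k : ℕ), 1 ≤ k →
      ‖x‖ ^ (6 - γ) *
        ∫ ζ in Metric.ball (0 : EuclideanSpace ℂ (Fin n)) (Real.exp (-Real.exp ((k : ℝ) - 1) / 2)) \
            Metric.closedBall (0 : EuclideanSpace ℂ (Fin n)) (Real.exp (-Real.exp ((k : ℝ) + 1) / 2)),
          ‖ζ‖ ^ (γ - 4) / (‖ζ - x‖ ^ α * ‖ζ + x‖ ^ β * |Real.log ‖ζ‖|) ≤ C := by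
  have hfin : Module.finrank ℝ (EuclideanSpace ℂ (Fin n)) = 2 * n := by
    rw [finrank_real_of_complex, finrank_euclideanSpace_fin]
  have hcast : (Module.finrank ℝ (EuclideanSpace ℂ (Fin n)) : ℝ) = 2 * n := by
    rw [hfin]; push_cast; ring
  have : Nontrivial (EuclideanSpace ℂ (Fin n)) :=
    Module.nontrivial_of_finrank_pos (R := ℝ) (by omega)
  have hmain := fun {a b : ℝ} => rpow_mul_setIntegral_annulus_le (a := a) (b := b)
    (volume : Measure (EuclideanSpace ℂ (Fin n))) (by omega) hγ0 hγ6 hα0 (by rwa [hcast]) hβ0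
    (by rwa [hcast]) (by rwa [hcast])
  set M := Module.finrank ℝ (EuclideanSpace ℂ (Fin n)) *
    (volume : Measure (EuclideanSpace ℂ (Fin n))).real (Metric.ball 0 1)
  set D := (Module.finrank ℝ (EuclideanSpace ℂ (Fin n)) : ℝ)
  refine ⟨|M * (2 ^ (D + 2) * 2 + 32 * (3 ^ (D - β) / (D - β)) +
    32 * (3 ^ (D - α) / (D - α)))| + 1, by positivity, fun x k hk => ?_⟩
  have hk' : (1 : ℝ) ≤ k := by exact_mod_cast hk
  have hexp : 1 ≤ Real.exp ((k : ℝ) - 1) := Real.one_le_exp (by linarith)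
  have hlog : ∀ t : ℝ, Real.log (-Real.log (Real.exp (-Real.exp t / 2))) = t - Real.log 2 := by
    intro t
    rw [Real.log_exp, neg_div, neg_neg, Real.log_div (Real.exp_pos t).ne' two_ne_zero,
      Real.log_exp]
  have h := hmain (Real.exp_pos (-Real.exp ((k : ℝ) + 1) / 2))
    (b := Real.exp (-Real.exp ((k : ℝ) - 1) / 2))
    (by gcongr; linarith) (by gcongr) x
  rw [hlog, hlog, show (k : ℝ) + 1 - Real.log 2 - (k - 1 - Real.log 2) = 2 by ring] at h
  exact h.trans ((le_abs_self _).trans (by linarith))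
end
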